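/- Let T be a special order tree. Then the ray space R(T) contains a dense subspace that is completely metrizable. -/

import Mathlib

open Set Topology

universe u v

/-- An order tree: a partial order with a minimum element (the root) in which
the set of predecessors of every element is a well-ordered chain. -/
def IsOrderTree (T : Type u) [PartialOrder T] : Prop :=
  (∃ r : T, ∀ t : T, r ≤ t) ∧
    ∀ t : T, IsChain (· ≤ ·) (Set.Iic t) ∧ (Set.Iic t).IsWF

/-- A tree is special if it is the union of countably many antichains. -/
def IsSpecialTree (T : Type u) [PartialOrder T] : Prop :=
  ∃ A : ℕ → Set T, (∀ n, IsAntichain (· ≤ ·) (A n)) ∧ (⋃ n, A n) = Set.univ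

/-- A path of `T`: a down-closed chain. -/
def IsPath {T : Type u} [PartialOrder T] (x : Set T) : Prop :=
  IsChain (· ≤ ·) x ∧ ∀ ⦃s t : T⦄, s ≤ t → t ∈ x → s ∈ x

/-- A ray: a path with no maximal element. -/
def IsRay {T : Type u} [PartialOrder T] (x : Set T) : Prop :=
  IsPath x ∧ ∀ t ∈ x, ∃ s ∈ x, t < s

/-- A branch: an inclusion-wise maximal path. -/
def IsBranch {T : Type u} [PartialOrder T] (x : Set T) : Prop :=
  IsPath x ∧ ∀ y : Set T, IsPath y → x ⊆ y → y = x

/-- The product topology of `2^T`, transported to `Set T` via characteristic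
functions: it is generated by the sets `{s | t ∈ s}` and their complements. -/
def cylinderTopology (T : Type u) : TopologicalSpace (Set T) :=
  TopologicalSpace.generateFrom
    {C : Set (Set T) | ∃ t : T, C = {s : Set T | t ∈ s} ∨ C = {s : Set T | t ∉ s}}

/-- The path space `P(T)`. -/
def PathSpace (T : Type u) [PartialOrder T] : Type u := {x : Set T // IsPath x}

/-- The ray space `R(T)`. -/
def RaySpace (T : Type u) [PartialOrder T] : Type u := {x : Set T // IsRay x}

/-- The branch space `B(T)`. -/
def BranchSpace (T : Type u) [PartialOrder T] : Type u := {x : Set T // IsBranch x}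

instance PathSpace.topologicalSpace (T : Type u) [PartialOrder T] :
    TopologicalSpace (PathSpace T) :=
  TopologicalSpace.induced (fun x => x.1) (cylinderTopology T)

instance RaySpace.topologicalSpace (T : Type u) [PartialOrder T] :
    TopologicalSpace (RaySpace T) :=
  TopologicalSpace.induced (fun x => x.1) (cylinderTopology T)

instance BranchSpace.topologicalSpace (T : Type u) [PartialOrder T] :
    TopologicalSpace (BranchSpace T) :=
  TopologicalSpace.induced (fun x => x.1) (cylinderTopology T)

/-- The subbasic set `[t] = {x ∈ R(T) : t ∈ x}`. -/
def raySet {T : Type u} [PartialOrder T] (t : T) : Set (RaySpace T) := {x | t ∈ x.1}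

/-- The basic set `[t] = {x ∈ B(T) : t ∈ x}`. -/
def branchSet {T : Type u} [PartialOrder T] (t : T) : Set (BranchSpace T) := {x | t ∈ x.1}

/-- A top of a ray `x` is a node whose set of strict predecessors is exactly `x`. -/
def IsTopOf {T : Type u} [PartialOrder T] (t : T) (x : Set T) : Prop := Set.Iio t = x

/-- `s` is a successor of `t`. -/
def IsSuccessorOf {T : Type u} [PartialOrder T] (s t : T) : Prop :=
  t < s ∧ ∀ u : T, t < u → u < s → False

/-- A tree is pruned if every node has a successor. -/
def IsPruned (T : Type u) [PartialOrder T] : Prop := ∀ t : T, ∃ s : T, IsSuccessorOf s t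

/-- A family of sets is nested if any two intersecting members are ⊆-comparable. -/
def NestedFam {X : Type v} (𝒜 : Set (Set X)) : Prop :=
  ∀ A ∈ 𝒜, ∀ B ∈ 𝒜, (A ∩ B).Nonempty → A ⊆ B ∨ B ⊆ A

/-- A family of sets is noetherian if every ⊆-increasing sequence of its members
is eventually constant. -/
def NoetherianFam {X : Type v} (𝒜 : Set (Set X)) : Prop :=
  ∀ f : ℕ → Set X, (∀ n, f n ∈ 𝒜) → Monotone f → ∃ N, ∀ n, N ≤ n → f n = f N

/-- A family of sets is centered if every finite subfamily has nonempty intersection. -/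
def CenteredFam {X : Type v} (𝒜 : Set (Set X)) : Prop :=
  ∀ F : Finset (Set X), ↑F ⊆ 𝒜 → (⋂₀ (F : Set (Set X))).Nonempty

/-- A family of sets is complete if every centered subfamily has nonempty intersection. -/
def CompleteFam {X : Type v} (𝒜 : Set (Set X)) : Prop :=
  ∀ 𝒞 ⊆ 𝒜, CenteredFam 𝒞 → (⋂₀ 𝒞).Nonempty

/-- A family is hereditarily complete if its trace on every closed set is complete. -/
def HeredCompleteFam {X : Type v} [TopologicalSpace X] (𝒜 : Set (Set X)) : Prop :=
  ∀ Y : Set X, IsClosed Y → CompleteFam {B : Set X | ∃ A ∈ 𝒜, B = A ∩ Y}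

/-- A family is σ-disjoint if it is a countable union of pairwise disjoint subfamilies. -/
def SigmaDisjointFam {X : Type v} (𝒜 : Set (Set X)) : Prop :=
  ∃ D : ℕ → Set (Set X), (∀ n, (D n).Pairwise Disjoint) ∧ (⋃ n, D n) = 𝒜

/-- `S` is a clopen subbase for `X` if the topology of `X` is the coarsest one in which
every member of `S` is clopen, i.e. it is generated by `S` together with the complements
of members of `S`. -/
def IsClopenSubbase {X : Type v} [t : TopologicalSpace X] (S : Set (Set X)) : Prop :=
  t = TopologicalSpace.generateFrom (S ∪ {B : Set X | ∃ A ∈ S, B = Aᶜ})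

/-- `B` is a base for the topology of `X`. -/
def IsBaseFam {X : Type v} [TopologicalSpace X] (B : Set (Set X)) : Prop :=
  (∀ U ∈ B, IsOpen U) ∧ ∀ U : Set X, IsOpen U → ∀ x ∈ U, ∃ V ∈ B, x ∈ V ∧ V ⊆ U

open TopologicalSpace

/-- Zorn's lemma for disjoint families: a maximal disjoint family of nonempty sets with
property `Q` meets every nonempty set with property `Q`. -/
theorem exists_maximal_pairwiseDisjoint {X : Type v} (Q : Set X → Prop) :
    ∃ 𝒱 : Set (Set X), (∀ V ∈ 𝒱, Q V) ∧ (∀ V ∈ 𝒱, ∀ W ∈ 𝒱, (V ∩ W).Nonempty → V = W) ∧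
      ∀ W, Q W → W.Nonempty → ∃ V ∈ 𝒱, (W ∩ V).Nonempty := by
  obtain ⟨𝒱, h𝒱⟩ := zorn_subset
    {𝒱 : Set (Set X) | (∀ V ∈ 𝒱, Q V) ∧ ∀ V ∈ 𝒱, ∀ W ∈ 𝒱, (V ∩ W).Nonempty → V = W} (by
      intro c hc hchain
      refine ⟨⋃₀ c, ⟨?_, ?_⟩, fun s hs => subset_sUnion_of_mem hs⟩
      · rintro V ⟨s, hs, hV⟩
        exact (hc hs).1 V hV
      · rintro V ⟨s, hs, hV⟩ W ⟨s', hs', hW⟩ hVW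
        rcases hchain.total hs hs' with h | h
        · exact (hc hs').2 V (h hV) W hW hVW
        · exact (hc hs).2 V hV W (h hW) hVW)
  refine ⟨𝒱, h𝒱.prop.1, h𝒱.prop.2, fun W hW hne => ?_⟩
  by_contra! hdisj
  have hins : insert W 𝒱 ⊆ 𝒱 := by
    refine h𝒱.le_of_ge ⟨?_, ?_⟩ (subset_insert W 𝒱)
    · rintro V (rfl | hV)
      exacts [hW, h𝒱.prop.1 V hV]
    · rintro V (rfl | hV) V' (rfl | hV') hVV'
      · rfl
      · exact absurd hVV' (by simp [hdisj V' hV'])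
      · rw [inter_comm] at hVV'
        exact absurd hVV' (by simp [hdisj V hV])
      · exact h𝒱.prop.2 V hV V' hV' hVV'
  have := hdisj W (hins (mem_insert W 𝒱))
  rw [inter_self] at this
  exact hne.ne_empty this

/-- If for every `n` the open sets satisfying `P n` form a `π`-base, and every decreasing sequence
of sets `W n` satisfying `P n` is a neighbourhood base at some point of its intersection, then the
space has a dense completely metrizable subspace. -/
theorem exists_dense_isCompletelyMetrizableSpace {X : Type v} [TopologicalSpace X] [T1Space X]
    (P : ℕ → Set X → Prop) (hopen : ∀ n W, P n W → IsOpen W)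
    (hne : ∀ n W, P n W → W.Nonempty)
    (hbase : ∀ n U, IsOpen U → U.Nonempty → ∃ W ⊆ U, P n W)
    (hconv : ∀ W : ℕ → Set X, Antitone W → (∀ n, P n (W n)) →
      ∃ x, (∀ n, x ∈ W n) ∧ ∀ O, IsOpen O → x ∈ O → ∃ n, W n ⊆ O) :
    ∃ D : Set X, Dense D ∧ IsCompletelyMetrizableSpace D := by
  choose part hpart hdisj hmax using
    fun (n : ℕ) (U : Set X) => exists_maximal_pairwiseDisjoint fun W => W ⊆ U ∧ P n W
  let τ : TopologicalSpace (Set X) := ⊥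
  have : DiscreteTopology (Set X) := ⟨rfl⟩
  let C : Set (ℕ → Set X) := {f | f 0 = univ ∧ ∀ n, f (n + 1) ∈ part n (f n)}
  have hCclosed : IsClosed C := by
    refine IsClosed.inter ?_ ?_
    · exact (isClosed_discrete {(univ : Set X)}).preimage (continuous_apply (A := fun _ => Set X) 0)
    · change IsClosed {f : ℕ → Set X | ∀ n, f (n + 1) ∈ part n (f n)}
      rw [ofPred_forall]
      refine isClosed_iInter fun n => ?_
      exact (isClosed_discrete {p : Set X × Set X | p.2 ∈ part n p.1}).preimage
        (f := fun f : ℕ → Set X => (f n, f (n + 1))) (by fun_prop)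
  have hCanti : ∀ f ∈ C, Antitone f := fun f hf =>
    antitone_nat_of_succ_le fun n => (hpart n _ _ (hf.2 n)).1
  have hCP : ∀ f ∈ C, ∀ n, P n (f (n + 1)) := fun f hf n => (hpart n _ _ (hf.2 n)).2
  have hCeq : ∀ f ∈ C, ∀ f' ∈ C, ∀ n, (f n ∩ f' n).Nonempty → f n = f' n := by
    intro f hf f' hf' n
    induction n with
    | zero => intro _; rw [hf.1, hf'.1]
    | succ n ih =>
      rintro ⟨x, hx, hx'⟩
      have h := ih ⟨x, hCanti f hf n.le_succ hx, hCanti f' hf' n.le_succ hx'⟩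
      exact hdisj n (f n) _ (hf.2 n) _ (h ▸ hf'.2 n) ⟨x, hx, hx'⟩
  have hlim : ∀ f : C, ∃ x, (∀ n, x ∈ f.1 n) ∧ ∀ O, IsOpen O → x ∈ O → ∃ n, f.1 n ⊆ O := by
    intro f
    obtain ⟨x, hx, hO⟩ := hconv (fun n => f.1 (n + 1))
      (fun m n h => hCanti f.1 f.2 (Nat.succ_le_succ h)) (hCP f.1 f.2)
    refine ⟨x, fun n => hCanti f.1 f.2 n.le_succ (hx n), fun O h h' => ?_⟩
    obtain ⟨n, hn⟩ := hO O h h'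
    exact ⟨n + 1, hn⟩
  choose g hg hgO using hlim
  have hgeq : ∀ f f' : C, ∀ n, g f' ∈ f.1 n → f'.1 n = f.1 n := fun f f' n h =>
    hCeq _ f'.2 _ f.2 n ⟨g f', hg f' n, h⟩
  have hCopen : ∀ f ∈ C, ∀ n, IsOpen (f n) := by
    rintro f hf (_ | n)
    · rw [hf.1]
      exact isOpen_univ
    · exact hopen n _ (hCP f hf n)
  have hgind : IsInducing g := by
    refine ⟨le_antisymm ?_ ?_⟩
    · rw [← continuous_iff_le_induced, continuous_iff_continuousAt]
      intro f
      rw [ContinuousAt, tendsto_nhds]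
      intro O hO hfO
      obtain ⟨n, hn⟩ := hgO f O hO hfO
      have hcont : Continuous fun f' : C => f'.1 n :=
        (continuous_apply (A := fun _ => Set X) n).comp continuous_subtype_val
      filter_upwards [((isOpen_discrete {f.1 n}).preimage hcont).mem_nhds rfl] with f' hf'
      have h : f'.1 n = f.1 n := hf'
      exact hn (h ▸ hg f' n)
    · let σ : TopologicalSpace C := induced g inferInstance
      change σ ≤ induced Subtype.val inferInstance
      rw [← continuous_iff_le_induced]
      refine continuous_pi fun n => continuous_discrete_rng.2 fun V => ?_
      refine isOpen_iff_mem_nhds.2 fun f hf => ?_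
      have hf : f.1 n = V := hf
      refine Filter.mem_of_superset (IsOpen.mem_nhds (s := g ⁻¹' f.1 n)
        ⟨f.1 n, hCopen f.1 f.2 n, rfl⟩ (hg f n)) fun f' hf' => ?_
      exact (hgeq f f' n hf').trans hf
  have hginj : Function.Injective g := fun f f' h =>
    Subtype.ext (funext fun n => hgeq f' f n (h ▸ hg f' n))
  refine ⟨range g, ?_, ?_⟩
  · rw [dense_iff_inter_open]
    intro U hU hUne
    let S := {p : Set X × Set X // IsOpen p.1 ∧ p.1.Nonempty ∧ p.1 ⊆ p.2}
    have hstep : ∀ (n : ℕ) (p : S), ∃ q : S,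
        q.1.2 ∈ part n p.1.2 ∧ q.1.1 ⊆ p.1.1 ∧ P n q.1.1 ∧ IsOpen q.1.2 := by
      rintro n ⟨⟨O, V⟩, hO, hOne, hOV⟩
      obtain ⟨W, hWO, hW⟩ := hbase n O hO hOne
      obtain ⟨V', hV', hWV'⟩ := hmax n V W ⟨hWO.trans hOV, hW⟩ (hne n W hW)
      have hV'o := hopen n _ (hpart n _ _ hV').2
      obtain ⟨O', hO', hPO'⟩ := hbase n (W ∩ V') ((hopen n W hW).inter hV'o) hWV'
      exact ⟨⟨(O', V'), hopen n _ hPO', hne n _ hPO', fun x hx => (hO' hx).2⟩, hV',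
        fun x hx => hWO (hO' hx).1, hPO', hV'o⟩
    choose next hnext using hstep
    let s : ℕ → S := fun n =>
      Nat.rec ⟨(U, univ), hU, hUne, subset_univ U⟩ (fun n p => next n p) n
    let f : C := ⟨fun n => (s n).1.2, rfl, fun n => (hnext n (s n)).1⟩
    have hanti : Antitone fun n => (s n).1.1 :=
      antitone_nat_of_succ_le fun n => (hnext n (s n)).2.1
    obtain ⟨z, hz, -⟩ := hconv (fun n => (s (n + 1)).1.1)
      (fun m n h => hanti (Nat.succ_le_succ h)) (fun n => (hnext n (s n)).2.2.1)
    have hzs : ∀ n, z ∈ (s n).1.1 := fun n => hanti n.le_succ (hz n)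
    have hzf : g f = z := by
      by_contra hgz
      obtain ⟨n, hn⟩ := hgO f {z}ᶜ isOpen_compl_singleton hgz
      exact hn ((s n).2.2.2 (hzs n)) rfl
    exact ⟨z, hzs 0, f, hzf⟩
  · have : IsCompletelyMetrizableSpace C := hCclosed.isCompletelyMetrizableSpace
    have e : range g ≃ₜ C := (IsEmbedding.mk hgind hginj).toHomeomorph.symm
    exact e.isClosedEmbedding.IsCompletelyMetrizableSpace

section RaySpaceOfTree

variable {T : Type u} [PartialOrder T]

theorem IsOrderTree.wellFoundedLT (hT : IsOrderTree T) : WellFoundedLT T := by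
  refine ⟨WellFounded.wellFounded_iff_has_min.2 fun S ⟨t, ht⟩ => ?_⟩
  have hwf : (Iic t ∩ S).IsWF := (hT.2 t).2.mono inter_subset_left
  have hne : (Iic t ∩ S).Nonempty := ⟨t, le_refl t, ht⟩
  have hm := hwf.min_mem hne
  exact ⟨hwf.min hne, hm.2, fun x hx hxm => hwf.not_lt_min hne ⟨hxm.le.trans hm.1, hx⟩ hxm⟩

theorem IsPath.le_total {x : Set T} (hx : IsPath x) {s t : T} (hs : s ∈ x) (ht : t ∈ x) :
    s ≤ t ∨ t ≤ s :=
  hx.1.total hs ht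

theorem RaySpace.isPath (x : RaySpace T) : IsPath x.1 := x.2.1

theorem isOpen_raySet (t : T) : IsOpen (raySet t) :=
  ⟨{s | t ∈ s}, isOpen_generateFrom_of_mem ⟨t, Or.inl rfl⟩, rfl⟩

theorem isOpen_compl_raySet (t : T) : IsOpen (raySet t)ᶜ :=
  ⟨{s | t ∉ s}, isOpen_generateFrom_of_mem ⟨t, Or.inr rfl⟩, rfl⟩

theorem raySet_anti {s t : T} (h : s ≤ t) : raySet t ⊆ raySet s := fun x hx =>
  x.isPath.2 h hx

instance : T1Space (RaySpace T) := by
  refine t1Space_iff_exists_open.2 fun x y hxy => ?_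
  have : x.1 ≠ y.1 := fun h => hxy (Subtype.ext h)
  rw [Ne, Set.ext_iff, not_forall] at this
  obtain ⟨t, ht⟩ := this
  by_cases hx : t ∈ x.1
  · exact ⟨raySet t, isOpen_raySet t, hx, fun hy => ht (iff_of_true hx hy)⟩
  · exact ⟨(raySet t)ᶜ, isOpen_compl_raySet t, hx, fun hy => ht (iff_of_false hx hy)⟩

/-- Basic neighbourhoods in the ray space are given by finitely many nodes that have to be
contained in a ray and finitely many nodes that have to be avoided. -/
theorem exists_finite_basic_subset {O : Set (RaySpace T)} (hO : IsOpen O) {x : RaySpace T}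
    (hx : x ∈ O) : ∃ F G : Set T, F.Finite ∧ G.Finite ∧ F ⊆ x.1 ∧ Disjoint G x.1 ∧
      ∀ y : RaySpace T, F ⊆ y.1 → Disjoint G y.1 → y ∈ O := by
  obtain ⟨V, hV, rfl⟩ := hO
  change GenerateOpen _ V at hV
  induction hV with
  | basic V hV =>
    obtain ⟨t, rfl | rfl⟩ := hV
    · exact ⟨{t}, ∅, finite_singleton t, finite_empty, singleton_subset_iff.2 hx,
        empty_disjoint _, fun y hy _ => hy (mem_singleton t)⟩
    · exact ⟨∅, {t}, finite_empty, finite_singleton t, empty_subset _,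
        disjoint_singleton_left.2 hx, fun y _ hy => disjoint_singleton_left.1 hy⟩
  | univ =>
    exact ⟨∅, ∅, finite_empty, finite_empty, empty_subset _, empty_disjoint _,
      fun _ _ _ => trivial⟩
  | inter V W _ _ hV hW =>
    obtain ⟨F, G, hF, hG, hFx, hGx, h⟩ := hV hx.1
    obtain ⟨F', G', hF', hG', hFx', hGx', h'⟩ := hW hx.2
    exact ⟨F ∪ F', G ∪ G', hF.union hF', hG.union hG', union_subset hFx hFx',
      disjoint_union_left.2 ⟨hGx, hGx'⟩, fun y hFy hGy =>
        ⟨h y (subset_union_left.trans hFy) (disjoint_union_left.1 hGy).1,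
          h' y (subset_union_right.trans hFy) (disjoint_union_left.1 hGy).2⟩⟩
  | sUnion 𝒱 _ ih =>
    obtain ⟨V, hV, hxV⟩ := hx
    obtain ⟨F, G, hF, hG, hFx, hGx, h⟩ := ih V hV hxV
    exact ⟨F, G, hF, hG, hFx, hGx, fun y hFy hGy => ⟨V, hV, h y hFy hGy⟩⟩

theorem IsPath.exists_eq_Iio [WellFoundedLT T] {x y : Set T} (hx : IsPath x) (hy : IsPath y)
    (h : y ⊂ x) : ∃ m ∈ x, y = Iio m := by
  obtain ⟨m, ⟨hmx, hmy⟩, hmin⟩ := (wellFounded_lt (α := T)).has_min (x \ y)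
    (sdiff_nonempty.2 h.2)
  refine ⟨m, hmx, Subset.antisymm (fun s hs => ?_) fun s hs => ?_⟩
  · rcases hx.le_total (h.1 hs) hmx with hsm | hms
    · exact lt_of_le_of_ne hsm fun h => hmy (h ▸ hs)
    · exact absurd (hy.2 hms hs) hmy
  · by_contra hsy
    exact hmin s ⟨hx.2 (le_of_lt hs) hmx, hsy⟩ hs

theorem exists_minimal_ray [WellFoundedLT T] {U : Set (RaySpace T)} (hU : U.Nonempty) :
    ∃ x ∈ U, ∀ y ∈ U, ¬ y.1 ⊂ x.1 := by
  by_cases h : ∃ m : T, ∃ y ∈ U, y.1 = Iio m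
  · obtain ⟨m, ⟨x, hxU, hx⟩, hmin⟩ := (wellFounded_lt (α := T)).has_min
      {m : T | ∃ y ∈ U, y.1 = Iio m} h
    refine ⟨x, hxU, fun y hyU hyx => ?_⟩
    obtain ⟨m', hm', hy⟩ := x.isPath.exists_eq_Iio y.isPath hyx
    rw [hx] at hm'
    exact hmin m' ⟨y, hyU, hy⟩ hm'
  · obtain ⟨x, hx⟩ := hU
    refine ⟨x, hx, fun y hyU hyx => h ?_⟩
    obtain ⟨m, -, hm⟩ := x.isPath.exists_eq_Iio y.isPath hyx
    exact ⟨m, y, hyU, hm⟩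

/-- Isolated points and the nonempty sets `[t]` form a `π`-base of the ray space. -/
theorem exists_singleton_or_raySet_subset (hT : IsOrderTree T) {U : Set (RaySpace T)}
    (hU : IsOpen U) (hne : U.Nonempty) :
    (∃ x ∈ U, IsOpen {x}) ∨ ∃ t, (raySet t).Nonempty ∧ raySet t ⊆ U := by
  have := hT.wellFoundedLT
  obtain ⟨x, hxU, hmin⟩ := exists_minimal_ray hne
  obtain ⟨F, G, hF, hG, hFx, hGx, hFG⟩ := exists_finite_basic_subset hU hxU
  have hfirst : ∀ b : T, ∃ c, b ∉ x.1 → c ≤ b ∧ c ∉ x.1 ∧ ∀ s ≤ b, s ∉ x.1 → c ≤ s := by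
    intro b
    by_cases hb : b ∈ x.1
    · exact ⟨b, fun h => absurd hb h⟩
    obtain ⟨c, ⟨hcb, hcx⟩, hc⟩ := (wellFounded_lt (α := T)).has_min (Iic b \ x.1)
      ⟨b, le_refl b, hb⟩
    refine ⟨c, fun _ => ⟨hcb, hcx, fun s hsb hsx => ?_⟩⟩
    rcases (hT.2 b).1.total hcb hsb with h | h
    · exact h
    · rcases h.lt_or_eq with h | h
      · exact absurd h (hc s ⟨hsb, hsx⟩)
      · exact h.ge
  choose c hc using hfirst
  have hGx' : ∀ b ∈ G, b ∉ x.1 := fun b hb => disjoint_left.1 hGx hb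
  let W : Set (RaySpace T) := (⋂ t ∈ F, raySet t) ∩ ⋂ b ∈ G, (raySet (c b))ᶜ
  have hmemW : ∀ y : RaySpace T, y ∈ W ↔ (∀ t ∈ F, t ∈ y.1) ∧ ∀ b ∈ G, c b ∉ y.1 := by
    intro y
    simp [W, raySet]
  have hW : IsOpen W := (hF.isOpen_biInter fun t _ => isOpen_raySet t).inter
    (hG.isOpen_biInter fun b _ => isOpen_compl_raySet (c b))
  have hxW : x ∈ W := (hmemW x).2 ⟨fun t ht => hFx ht, fun b hb => (hc b (hGx' b hb)).2.1⟩
  have hWU : W ⊆ U := by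
    intro y hy
    rw [hmemW] at hy
    refine hFG y hy.1 (disjoint_left.2 fun b hb hby => hy.2 b hb ?_)
    exact y.isPath.2 (hc b (hGx' b hb)).1 hby
  by_cases hWx : W = {x}
  · exact Or.inl ⟨x, hxU, hWx ▸ hW⟩
  right
  obtain ⟨y, hyW, hyx⟩ : ∃ y ∈ W, y ≠ x := by
    by_contra! h
    exact hWx (Subset.antisymm h (singleton_subset_iff.2 hxW))
  obtain ⟨s, hsy, hsx⟩ : ∃ s ∈ y.1, s ∉ x.1 := by
    by_contra! h
    exact hmin y (hWU hyW) (ssubset_of_subset_of_ne h fun h => hyx (Subtype.ext h))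
  refine ⟨s, ⟨y, hsy⟩, fun z hz => hWU ((hmemW z).2 ⟨fun t ht => ?_, fun b hb hbz => ?_⟩)⟩
  · rcases y.isPath.le_total (((hmemW y).1 hyW).1 t ht) hsy with h | h
    · exact z.isPath.2 h hz
    · exact absurd (x.isPath.2 h (hFx ht)) hsx
  · obtain ⟨hcb, hcx, hcs⟩ := hc b (hGx' b hb)
    have hcy := ((hmemW y).1 hyW).2 b hb
    rcases z.isPath.le_total hbz hz with h | h
    · exact hcy (y.isPath.2 h hsy)
    · exact hcy (y.isPath.2 (hcs s (h.trans hcb) hsx) hsy)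

/-- An open set decides `A` if it is an isolated point, or a nonempty set `[t]` such that no
element of `A` strictly above `t` lies on a ray. -/
def DecidesNodes (A : Set T) (W : Set (RaySpace T)) : Prop :=
  (∃ x, W = {x} ∧ IsOpen {x}) ∨
    ∃ t, W = raySet t ∧ (raySet t).Nonempty ∧ ∀ s ∈ A, t ≤ s → (raySet s).Nonempty → s ≤ t

theorem DecidesNodes.isOpen {A : Set T} {W : Set (RaySpace T)} (h : DecidesNodes A W) :
    IsOpen W := by
  obtain ⟨x, rfl, hx⟩ | ⟨t, rfl, -⟩ := h
  exacts [hx, isOpen_raySet t]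

theorem DecidesNodes.nonempty {A : Set T} {W : Set (RaySpace T)} (h : DecidesNodes A W) :
    W.Nonempty := by
  obtain ⟨x, rfl, hx⟩ | ⟨t, rfl, ht, -⟩ := h
  exacts [singleton_nonempty x, ht]

theorem exists_decidesNodes_subset (hT : IsOrderTree T) {A : Set T}
    (hA : IsAntichain (· ≤ ·) A) {U : Set (RaySpace T)} (hU : IsOpen U) (hne : U.Nonempty) :
    ∃ W ⊆ U, DecidesNodes A W := by
  obtain ⟨x, hxU, hx⟩ | ⟨t, htne, htU⟩ := exists_singleton_or_raySet_subset hT hU hne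
  · exact ⟨{x}, singleton_subset_iff.2 hxU, Or.inl ⟨x, rfl, hx⟩⟩
  by_cases h : ∃ s ∈ A, t ≤ s ∧ (raySet s).Nonempty
  · obtain ⟨s, hsA, hts, hsne⟩ := h
    exact ⟨raySet s, (raySet_anti hts).trans htU,
      Or.inr ⟨s, rfl, hsne, fun s' hs' hss' _ => (hA.eq hsA hs' hss').ge⟩⟩
  · exact ⟨raySet t, htU,
      Or.inr ⟨t, rfl, htne, fun s hs hts hsne => absurd ⟨s, hs, hts, hsne⟩ h⟩⟩

theorem exists_ray_of_antitone_decidesNodes {A : ℕ → Set T} (hA : ⋃ n, A n = univ)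
    {W : ℕ → Set (RaySpace T)} (hW : Antitone W) (hAW : ∀ n, DecidesNodes (A n) (W n)) :
    ∃ x, (∀ n, x ∈ W n) ∧ ∀ O, IsOpen O → x ∈ O → ∃ n, W n ⊆ O := by
  by_cases hsing : ∃ n x, W n = {x}
  · obtain ⟨n, x, hx⟩ := hsing
    refine ⟨x, fun k => ?_, fun O _ hxO => ⟨n, hx ▸ singleton_subset_iff.2 hxO⟩⟩
    rcases le_total k n with h | h
    · exact hW h (hx ▸ mem_singleton x)
    · obtain ⟨y, hy⟩ := (hAW k).nonempty
      have hyx : y = x := by simpa [hx] using hW h hy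
      exact hyx ▸ hy
  have hnode : ∀ n, ∃ t, W n = raySet t ∧ ∀ s ∈ A n, t ≤ s → (raySet s).Nonempty → s ≤ t := by
    intro n
    obtain ⟨x, hx, -⟩ | ⟨t, ht, -, h⟩ := hAW n
    · exact absurd ⟨n, x, hx⟩ hsing
    · exact ⟨t, ht, h⟩
  choose t ht hdec using hnode
  have hmemA : ∀ s, ∃ n, s ∈ A n := fun s => mem_iUnion.1 (hA ▸ mem_univ s)
  have hcommon : ∀ m n, ∃ y : RaySpace T, t m ∈ y.1 ∧ t n ∈ y.1 := by
    intro m n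
    obtain ⟨y, hy⟩ := (hAW (max m n)).nonempty
    have hm := hW (le_max_left m n) hy
    have hn := hW (le_max_right m n) hy
    rw [ht] at hm hn
    exact ⟨y, hm, hn⟩
  have htotal : ∀ m n, t m ≤ t n ∨ t n ≤ t m := by
    intro m n
    obtain ⟨y, hm, hn⟩ := hcommon m n
    exact y.isPath.le_total hm hn
  have hgrow : ∀ n, ∃ m, t n < t m := by
    intro n
    by_contra! h
    have hle : ∀ m, t m ≤ t n := by
      intro m
      rcases htotal m n with h' | h'
      · exact h'
      · exact (eq_of_le_of_not_lt h' (h m)).ge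
    obtain ⟨y, hy, -⟩ := hcommon n n
    obtain ⟨s, hsy, hts⟩ := y.2.2 (t n) hy
    obtain ⟨m, hm⟩ := hmemA s
    exact (hdec m s hm ((hle m).trans hts.le) ⟨y, hsy⟩).not_gt ((hle m).trans_lt hts)
  have hray : IsRay {s | ∃ n, s ≤ t n} := by
    refine ⟨⟨?_, ?_⟩, ?_⟩
    · rintro a ⟨m, hm⟩ b ⟨n, hn⟩ -
      obtain ⟨y, hym, hyn⟩ := hcommon m n
      exact y.isPath.le_total (y.isPath.2 hm hym) (y.isPath.2 hn hyn)
    · rintro a b hab ⟨n, hn⟩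
      exact ⟨n, hab.trans hn⟩
    · rintro a ⟨n, hn⟩
      obtain ⟨m, hm⟩ := hgrow n
      exact ⟨t m, ⟨m, le_rfl⟩, hn.trans_lt hm⟩
  refine ⟨⟨_, hray⟩, fun n => ht n ▸ ⟨n, le_rfl⟩, fun O hO hxO => ?_⟩
  obtain ⟨F, G, hF, hG, hFx, hGx, hFG⟩ := exists_finite_basic_subset hO hxO
  have hFW : ∀ᶠ n in Filter.atTop, ∀ s ∈ F, W n ⊆ raySet s := by
    refine (Filter.eventually_all_finite hF).2 fun s hs => ?_
    obtain ⟨n, hn⟩ := hFx hs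
    filter_upwards [Filter.eventually_ge_atTop n] with m hm
    exact (hW hm).trans (ht n ▸ raySet_anti hn)
  have hGW : ∀ᶠ n in Filter.atTop, ∀ b ∈ G, W n ⊆ (raySet b)ᶜ := by
    refine (Filter.eventually_all_finite hG).2 fun b hb => ?_
    obtain ⟨n, hn⟩ := hmemA b
    filter_upwards [Filter.eventually_ge_atTop n] with m hm
    refine (hW hm).trans fun z hz hbz => ?_
    rw [ht] at hz
    refine disjoint_left.1 hGx hb ⟨n, ?_⟩
    rcases z.isPath.le_total hbz hz with h | h
    exacts [h, hdec n b hn h ⟨z, hbz⟩]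
  obtain ⟨n, hFn, hGn⟩ := (hFW.and hGW).exists
  exact ⟨n, fun z hz => hFG z (fun s hs => hFn s hs hz)
    (disjoint_left.2 fun b hb hbz => hGn b hb hz hbz)⟩

end RaySpaceOfTree

/-- The ray space of a special order tree contains a dense, completely
metrizable subspace. -/
theorem stmt11 {T : Type u} [PartialOrder T] (hT : IsOrderTree T)
    (hsp : IsSpecialTree T) :
    ∃ D : Set (RaySpace T), Dense D ∧
      ∃ m : MetricSpace D,
        m.toUniformSpace.toTopologicalSpace = (inferInstanceAs (TopologicalSpace D)) ∧
        @CompleteSpace D m.toUniformSpace := by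
  obtain ⟨A, hA, hcover⟩ := hsp
  obtain ⟨D, hD, hDm⟩ := exists_dense_isCompletelyMetrizableSpace
    (fun n => DecidesNodes (A n)) (fun _ _ h => h.isOpen) (fun _ _ h => h.nonempty)
    (fun n _ hU hne => exists_decidesNodes_subset hT (hA n) hU hne)
    (fun _ hW hAW => exists_ray_of_antitone_decidesNodes hcover hW hAW)
  exact ⟨D, hD, hDm.complete⟩
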